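/- Let d ≥ 1 be an integer, let t ≠ 0 be a real number, and let p' ∈ [1,2] with conjugate exponent p (1/p + 1/p' = 1). Then there exists a constant c > 0 (depending only on d and p) such that for every Schwartz function φ : ℝ^d → ℂ one has ‖T(t)φ‖_{L^p} ≤ c · |t|^{−d(1/2 − 1/p)} · ‖φ‖_{L^{p'}}. -/

import Mathlib

open MeasureTheory Real Complex
open scoped ENNReal

/-- The free Schrödinger propagator `T(t)`, given by its kernel formula:
`(T(t)φ)(x) = (4πit)^(−d/2) ∫ e^{i|x−y|²/(4t)} φ(y) dy`, with the principal
branch of the complex power. -/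
noncomputable def schrodingerProp (d : ℕ) (t : ℝ)
    (φ : EuclideanSpace ℝ (Fin d) → ℂ) (x : EuclideanSpace ℝ (Fin d)) : ℂ :=
  (4 * Real.pi * Complex.I * t) ^ (-(d : ℂ) / 2) *
    ∫ y : EuclideanSpace ℝ (Fin d),
      Complex.exp (Complex.I * ((‖x - y‖ : ℝ) ^ 2 : ℝ) / (4 * t)) * φ y

open FourierTransform SchwartzMap
theorem fourier_planch {d : ℕ} {f : EuclideanSpace ℝ (Fin d) → ℂ} (h1 : Integrable f) (h2 : MemLp f 2) :
    eLpNorm (𝓕 f) 2 volume = eLpNorm f 2 volume := by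
  set F : Lp ℂ 2 (volume : Measure (EuclideanSpace ℝ (Fin d))) := h2.toLp f with hF
  have hcont : Continuous (𝓕 f) :=
    VectorFourier.fourierIntegral_continuous Real.continuous_fourierChar (L := innerₗ _) continuous_inner h1
  have key : 𝓕 f =ᵐ[volume] (𝓕 F : Lp ℂ 2 (volume : Measure (EuclideanSpace ℝ (Fin d)))) := by
    apply ae_eq_of_integral_contDiff_smul_eq
    · exact hcont.locallyIntegrable
    · exact (Lp.memLp _).locallyIntegrable (by norm_num)
    · intro g g_smooth g_cpt
      have hg₁ : HasCompactSupport (Complex.ofRealCLM ∘ g) := g_cpt.comp_left rfl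
      have hg₂ : ContDiff ℝ (⊤ : ℕ∞) (Complex.ofRealCLM ∘ g) := by fun_prop
      set G := hg₁.toSchwartzMap hg₂ with hG
      have e1 := congrArg (fun T => T G) (MeasureTheory.Lp.fourier_toTemperedDistribution_eq F)
      simp only [TemperedDistribution.fourier_apply, MeasureTheory.Lp.toTemperedDistribution_apply] at e1
      have e2 : ∫ x, g x • (𝓕 F : Lp ℂ 2 (volume : Measure (EuclideanSpace ℝ (Fin d)))) x = ∫ x, G x • (𝓕 F : Lp ℂ 2 (volume : Measure (EuclideanSpace ℝ (Fin d)))) x := by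
        simp [hG]
      rw [e2, ← e1]
      have e3 : ∫ x, (𝓕 G) x • F x = ∫ x, (𝓕 G) x • f x := by
        apply integral_congr_ae
        filter_upwards [h2.coeFn_toLp] with x hx
        rw [hF, hx]
      rw [e3]
      have e4 := VectorFourier.integral_fourierIntegral_smul_eq_flip (L := innerₗ (EuclideanSpace ℝ (Fin d)))
        Real.continuous_fourierChar continuous_inner (G.integrable (μ := volume)) h1
      have e5 : ∀ x, (𝓕 G) x = VectorFourier.fourierIntegral Real.fourierChar volume (innerₗ (EuclideanSpace ℝ (Fin d))) (⇑G) x := by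
        intro x; rw [SchwartzMap.fourier_coe]; rfl
      simp_rw [e5]
      rw [e4]
      apply integral_congr_ae
      filter_upwards with x
      rw [flip_innerₗ]
      simp [hG]; left; rfl
  rw [eLpNorm_congr_ae key]
  have h := MeasureTheory.Lp.norm_fourier_eq F
  rw [Lp.norm_def, Lp.norm_def, ENNReal.toReal_eq_toReal_iff' (Lp.memLp _).2.ne (Lp.memLp _).2.ne] at h
  rw [h]
  exact eLpNorm_congr_ae h2.coeFn_toLp


theorem fourier_cont {d : ℕ} {f : EuclideanSpace ℝ (Fin d) → ℂ} (h1 : Integrable f) :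
    Continuous (𝓕 f) :=
  VectorFourier.fourierIntegral_continuous Real.continuous_fourierChar (L := innerₗ _)
    continuous_inner h1

theorem fourier_norm_le {d : ℕ} (f : EuclideanSpace ℝ (Fin d) → ℂ) (x : EuclideanSpace ℝ (Fin d)) :
    ‖𝓕 f x‖ ≤ ∫ v, ‖f v‖ :=
  VectorFourier.norm_fourierIntegral_le_integral_norm _ _ _ _ _

theorem fourier_weak {d : ℕ} {f : EuclideanSpace ℝ (Fin d) → ℂ} (hm : Measurable f)
    (h1 : Integrable f) (h2 : MemLp f 2) {P q N : ℝ} (hP : 2 < P) (hq : q = P / (P - 1))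
    (hfq : Integrable (fun x => ‖f x‖ ^ q)) (hN : N = ∫ x, ‖f x‖ ^ q) (hN0 : 0 < N)
    {l : ℝ} (hl : 0 < l) :
    volume {x | l < ‖𝓕 f x‖} ≤
      ∫⁻ x, ENNReal.ofReal (4 / l ^ 2 * (if ‖f x‖ ≤ (2 * N / l) ^ (P - 1) then ‖f x‖ ^ 2 else 0)) := by
  set s := (2 * N / l) ^ (P - 1) with hs
  have hs0 : 0 < s := by positivity
  set A : Set (EuclideanSpace ℝ (Fin d)) := {x | ‖f x‖ ≤ s} with hA
  have hAm : MeasurableSet A := measurableSet_le hm.norm measurable_const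
  have hsum : f = A.indicator f + Aᶜ.indicator f := (Set.indicator_self_add_compl A f).symm
  have i1 : Integrable (A.indicator f) := h1.indicator hAm
  have i2 : Integrable (Aᶜ.indicator f) := h1.indicator hAm.compl
  have hq1 : 1 - q = - (1 / (P - 1)) := by
    rw [hq]; have : P - 1 ≠ 0 := by linarith
    field_simp; ring
  have hsq : s ^ (1 - q) = l / (2 * N) := by
    rw [hs, ← Real.rpow_mul (by positivity), hq1]
    have : (P - 1) * -(1 / (P - 1)) = -1 := by
      have : P - 1 ≠ 0 := by linarith
      field_simp
    rw [this, Real.rpow_neg_one, inv_div]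
  have hbig : ∀ x, ‖𝓕 (Aᶜ.indicator f) x‖ ≤ l / 2 := by
    intro x
    refine (fourier_norm_le _ x).trans ?_
    calc ∫ v, ‖Aᶜ.indicator f v‖ ≤ ∫ v, s ^ (1 - q) * ‖f v‖ ^ q := by
          apply integral_mono i2.norm (hfq.const_mul _)
          intro v
          by_cases hv : v ∈ A
          · simp [hv]; positivity
          · have hv' : s < ‖f v‖ := by simpa [hA] using hv
            have hf0 : 0 < ‖f v‖ := hs0.trans hv'
            simp only [Set.mem_compl_iff, hv, not_false_eq_true, Set.indicator_of_mem]
            have : ‖f v‖ ^ (1 - q) ≤ s ^ (1 - q) := by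
              apply Real.rpow_le_rpow_of_nonpos hs0 hv'.le
              rw [hq1]
              have : 0 < 1 / (P - 1) := by apply one_div_pos.2; linarith
              linarith
            calc ‖f v‖ = ‖f v‖ ^ (1 - q) * ‖f v‖ ^ q := by
                  rw [← Real.rpow_add hf0]; simp
              _ ≤ _ := by gcongr
      _ = l / 2 := by
          rw [integral_const_mul, ← hN, hsq]; field_simp
  have hadd : ∀ x, 𝓕 f x = 𝓕 (A.indicator f) x + 𝓕 (Aᶜ.indicator f) x := by
    intro x
    conv_lhs => rw [hsum]
    exact congrFun (VectorFourier.fourierIntegral_add Real.continuous_fourierChar (L := innerₗ _)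
      continuous_inner i1 i2) x
  have hsub : {x | l < ‖𝓕 f x‖} ⊆
      {x | ENNReal.ofReal (l / 2) ≤ ‖𝓕 (A.indicator f) x‖ₑ} := by
    intro x hx
    simp only [Set.mem_ofPred_eq] at hx ⊢
    rw [← ofReal_norm]
    apply ENNReal.ofReal_le_ofReal
    have := norm_add_le (𝓕 (A.indicator f) x) (𝓕 (Aᶜ.indicator f) x)
    rw [← hadd] at this
    linarith [hbig x]
  have hl2 : ENNReal.ofReal (l / 2) ≠ 0 := by simpa using hl
  have cheb := meas_ge_le_mul_pow_eLpNorm_enorm volume (p := 2) (by norm_num) (by norm_num)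
    (fourier_cont i1).aestronglyMeasurable hl2 (by simp)
  refine (measure_mono hsub).trans (cheb.trans ?_)
  rw [fourier_planch i1 (h2.indicator hAm),
    eLpNorm_eq_lintegral_rpow_enorm_toReal (by norm_num) (by norm_num), ← ENNReal.rpow_mul]
  simp only [ENNReal.toReal_ofNat, one_div, ne_eq, OfNat.ofNat_ne_zero, not_false_eq_true,
    inv_mul_cancel₀, ENNReal.rpow_one, ENNReal.rpow_ofNat]
  rw [← ENNReal.ofReal_inv_of_pos (by positivity), ← ENNReal.ofReal_pow (by positivity),
    ← lintegral_const_mul' _ _ (by simp)]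
  apply lintegral_mono
  intro x
  beta_reduce
  rw [← ofReal_norm, ← ENNReal.ofReal_pow (by positivity), ← ENNReal.ofReal_mul (by positivity)]
  apply ENNReal.ofReal_le_ofReal
  by_cases hx : x ∈ A
  · have hx' : ‖f x‖ ≤ s := hx
    simp only [hx, Set.indicator_of_mem, hx', if_true]
    apply le_of_eq; field_simp; ring
  · have hx' : ¬ ‖f x‖ ≤ s := hx
    simp [hx, hx']

theorem inner_bound {a P N : ℝ} (ha : 0 ≤ a) (hP : 2 < P) (hN0 : 0 < N) :
    ∫⁻ l in Set.Ioi (0:ℝ), ENNReal.ofReal (4 / l ^ 2 * (if a ≤ (2 * N / l) ^ (P - 1) then a ^ 2 else 0))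
      * ENNReal.ofReal (l ^ (P - 1)) ≤
      ENNReal.ofReal (4 / (P - 2) * (2 * N) ^ (P - 2) * a ^ (P / (P - 1))) := by
  rcases ha.eq_or_lt with rfl | ha
  · simp
  set R := 2 * N * a ^ (-(1 / (P - 1))) with hR
  have hR0 : 0 < R := by positivity
  have hP1 : P - 1 ≠ 0 := by linarith
  have hP2 : P - 2 ≠ 0 := by linarith
  calc _ ≤ ∫⁻ l in Set.Ioi (0:ℝ), (Set.Ioc 0 R).indicator
            (fun l => ENNReal.ofReal (4 * a ^ 2 * l ^ (P - 3))) l := by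
        apply setLIntegral_mono' measurableSet_Ioi
        intro l hl
        have hl : 0 < l := hl
        split_ifs with h
        · have hlR : l ≤ R := by
            have h1 : a ^ (1 / (P - 1)) ≤ 2 * N / l := by
              calc a ^ (1 / (P - 1)) ≤ ((2 * N / l) ^ (P - 1)) ^ (1 / (P - 1)) := by
                    apply Real.rpow_le_rpow ha.le h; apply one_div_nonneg.2; linarith
                _ = 2 * N / l := by
                    rw [← Real.rpow_mul (by positivity), mul_one_div_cancel hP1, Real.rpow_one]
            rw [hR, Real.rpow_neg ha.le, ← div_eq_mul_inv, le_div_iff₀ (by positivity)]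
            rw [le_div_iff₀ hl] at h1
            linarith
          rw [Set.indicator_of_mem (show l ∈ Set.Ioc 0 R from ⟨hl, hlR⟩),
            ← ENNReal.ofReal_mul (by positivity)]
          apply ENNReal.ofReal_le_ofReal
          have : l ^ (P - 1) = l ^ (P - 3) * l ^ 2 := by
            rw [← Real.rpow_natCast, ← Real.rpow_add hl]; congr 1; push_cast; ring
          rw [this]
          apply le_of_eq; field_simp
        · simp
    _ ≤ ∫⁻ l in Set.Ioc 0 R, ENNReal.ofReal (4 * a ^ 2 * l ^ (P - 3)) := by
        rw [← lintegral_indicator measurableSet_Ioc]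
        exact setLIntegral_le_lintegral _ _
    _ = ENNReal.ofReal (∫ l in Set.Ioc 0 R, 4 * a ^ 2 * l ^ (P - 3)) := by
        rw [ofReal_integral_eq_lintegral_ofReal]
        · have := (intervalIntegral.intervalIntegrable_rpow' (a := 0) (b := R)
            (show -1 < P - 3 by linarith)).const_mul (4 * a ^ 2)
          exact (intervalIntegrable_iff_integrableOn_Ioc_of_le hR0.le).1 this
        · filter_upwards [ae_restrict_mem measurableSet_Ioc] with l hl
          have := hl.1
          simp only [Pi.zero_apply]
          positivity
    _ = _ := by
        congr 1
        rw [← intervalIntegral.integral_of_le hR0.le, intervalIntegral.integral_const_mul,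
          integral_rpow (Or.inl (by linarith)), show P - 3 + 1 = P - 2 by ring,
          Real.zero_rpow hP2, hR, Real.mul_rpow (by positivity) (by positivity),
          ← Real.rpow_mul ha.le]
        have : a ^ (P / (P - 1)) = a ^ 2 * a ^ (-(1 / (P - 1)) * (P - 2)) := by
          rw [← Real.rpow_natCast, ← Real.rpow_add ha]; congr 1; push_cast; field_simp; ring
        rw [this]
        ring

theorem hy_aux {d : ℕ} {f : EuclideanSpace ℝ (Fin d) → ℂ} (hm : Measurable f)
    (h1 : Integrable f) (h2 : MemLp f 2) {P q N : ℝ} (hP : 2 < P) (hq : q = P / (P - 1))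
    (hfq : Integrable (fun x => ‖f x‖ ^ q)) (hN : N = ∫ x, ‖f x‖ ^ q) (hN0 : 0 < N) :
    ∫⁻ x, ENNReal.ofReal (‖𝓕 f x‖ ^ P) ≤
      ENNReal.ofReal (P * (4 / (P - 2)) * 2 ^ (P - 2) * N ^ (P - 1)) := by
  rw [lintegral_rpow_eq_lintegral_meas_lt_mul volume (Filter.Eventually.of_forall fun x => norm_nonneg _)
    (fourier_cont h1).norm.aemeasurable (by linarith)]
  have hP2 : 0 < P - 2 := by linarith
  calc _ ≤ ENNReal.ofReal P * ∫⁻ l in Set.Ioi (0:ℝ), ∫⁻ x, ENNReal.ofReal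
          (4 / l ^ 2 * (if ‖f x‖ ≤ (2 * N / l) ^ (P - 1) then ‖f x‖ ^ 2 else 0))
            * ENNReal.ofReal (l ^ (P - 1)) := by
        gcongr ENNReal.ofReal P * ?_
        apply setLIntegral_mono' measurableSet_Ioi
        intro l hl
        rw [lintegral_mul_const' _ _ (by simp)]
        gcongr
        exact fourier_weak hm h1 h2 hP hq hfq hN hN0 hl
    _ = ENNReal.ofReal P * ∫⁻ x, ∫⁻ l in Set.Ioi (0:ℝ), ENNReal.ofReal
          (4 / l ^ 2 * (if ‖f x‖ ≤ (2 * N / l) ^ (P - 1) then ‖f x‖ ^ 2 else 0))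
            * ENNReal.ofReal (l ^ (P - 1)) := by
        rw [lintegral_lintegral_swap]
        apply Measurable.aemeasurable
        have hS : MeasurableSet {z : ℝ × EuclideanSpace ℝ (Fin d) |
            ‖f z.2‖ ≤ (2 * N / z.1) ^ (P - 1)} :=
          measurableSet_le (by fun_prop) (by fun_prop)
        have m1 : Measurable (fun z : ℝ × EuclideanSpace ℝ (Fin d) =>
            if ‖f z.2‖ ≤ (2 * N / z.1) ^ (P - 1) then ‖f z.2‖ ^ 2 else 0) :=
          Measurable.ite hS (by fun_prop) measurable_const
        have m2 : Measurable (fun z : ℝ × EuclideanSpace ℝ (Fin d) => 4 / z.1 ^ 2) := by fun_prop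
        have m3 : Measurable (fun z : ℝ × EuclideanSpace ℝ (Fin d) =>
            ENNReal.ofReal (z.1 ^ (P - 1))) := by fun_prop
        exact (m2.mul m1).ennreal_ofReal.mul m3
    _ ≤ ENNReal.ofReal P * ∫⁻ x, ENNReal.ofReal (4 / (P - 2) * (2 * N) ^ (P - 2) * ‖f x‖ ^ q) := by
        gcongr with x
        rw [hq]
        exact inner_bound (norm_nonneg _) hP hN0
    _ = _ := by
        rw [← ofReal_integral_eq_lintegral_ofReal (hfq.const_mul _)
          (Filter.Eventually.of_forall fun x => by simp only [Pi.zero_apply]; positivity),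
          integral_const_mul, ← hN, ← ENNReal.ofReal_mul (by linarith)]
        congr 1
        have : N ^ (P - 1) = N ^ (P - 2) * N := by
          conv_rhs => rw [← Real.rpow_one N, ← Real.rpow_mul hN0.le, one_mul, ← Real.rpow_add hN0]
          congr 1; ring
        rw [this, Real.mul_rpow (by norm_num) hN0.le]
        ring

theorem hy {d : ℕ} (p p' : ℝ≥0∞)
    (hp'1 : 1 ≤ p') (hp'2 : p' ≤ 2) (hconj : 1 / p + 1 / p' = 1) :
    ∃ c : ℝ, 0 < c ∧ ∀ f : EuclideanSpace ℝ (Fin d) → ℂ, Measurable f → (∀ r : ℝ≥0∞, MemLp f r) →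
      eLpNorm (𝓕 f) p volume ≤ ENNReal.ofReal c * eLpNorm f p' volume := by
  rcases hp'1.eq_or_lt with rfl | hp1
  · refine ⟨1, one_pos, fun f _ hf => ?_⟩
    have hp : p = ∞ := by
      by_contra h
      have h0 : 1 / p + 1 = 0 + 1 := by simpa using hconj
      have := (ENNReal.add_left_inj ENNReal.one_ne_top).1 h0
      simp [h] at this
    subst hp
    rw [eLpNorm_exponent_top]
    refine eLpNormEssSup_le_of_ae_enorm_bound (Filter.Eventually.of_forall fun x => ?_)
    rw [eLpNorm_one_eq_lintegral_enorm, ENNReal.ofReal_one, one_mul,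
      ← ofReal_integral_norm_eq_lintegral_enorm (memLp_one_iff_integrable.1 (hf 1)), ← ofReal_norm]
    exact ENNReal.ofReal_le_ofReal (fourier_norm_le f x)
  rcases hp'2.eq_or_lt with rfl | hp2
  · refine ⟨1, one_pos, fun f _ hf => ?_⟩
    have hp : p = 2 := by
      have h0 : 1 / p + 1 / 2 = 1 / 2 + 1 / 2 := by
        rw [hconj, ENNReal.add_halves]
      have := (ENNReal.add_left_inj (by simp)).1 h0
      simpa using this
    subst hp
    rw [fourier_planch (memLp_one_iff_integrable.1 (hf 1)) (hf 2)]
    simp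
  have hp't : p' ≠ ∞ := (hp2.trans (by simp)).ne
  have hp'0 : p' ≠ 0 := (zero_lt_one.trans hp1).ne'
  set q := p'.toReal with hq
  have hq1 : 1 < q := by
    rw [hq, ← ENNReal.toReal_one]; exact (ENNReal.toReal_lt_toReal (by simp) hp't).2 hp1
  have hq2 : q < 2 := by
    rw [hq, ← ENNReal.toReal_ofNat 2]; exact (ENNReal.toReal_lt_toReal hp't (by simp)).2 hp2
  have hpt : p ≠ ∞ := by
    rintro rfl
    simp at hconj
    rw [hconj] at hp1
    exact lt_irrefl _ hp1
  have hp0 : p ≠ 0 := by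
    rintro rfl
    simp at hconj
  set P := p.toReal with hPdef
  have hPpos : 0 < P := ENNReal.toReal_pos hp0 hpt
  have hPq : 1 / P + 1 / q = 1 := by
    have := congrArg ENNReal.toReal hconj
    rw [ENNReal.toReal_add (by simpa using hp0) (by simpa using hp'0)] at this
    simpa [hq, hPdef] using this
  have hPq' : q + P = P * q := by field_simp at hPq; linarith
  have hP1 : 1 < P := by nlinarith
  have hP2 : 2 < P := by nlinarith
  have hqP : q = P / (P - 1) := by
    rw [eq_div_iff (by linarith)]; linarith
  set C := P * (4 / (P - 2)) * 2 ^ (P - 2) with hC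
  have hC0 : 0 < C := by
    have : 0 < P - 2 := by linarith
    positivity
  refine ⟨C ^ (1 / P), by positivity, fun f hm hf => ?_⟩
  have i1 := memLp_one_iff_integrable.1 (hf 1)
  have hfq : Integrable (fun x => ‖f x‖ ^ q) := (hf p').integrable_norm_rpow hp'0 hp't
  set N := ∫ x, ‖f x‖ ^ q with hN
  have hNn : 0 ≤ N := integral_nonneg fun x => by positivity
  have hN' : ∫⁻ x, ‖f x‖ₑ ^ q = ENNReal.ofReal N := by
    rw [hN, ofReal_integral_eq_lintegral_ofReal hfq
      (Filter.Eventually.of_forall fun x => by simp only [Pi.zero_apply]; positivity)]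
    congr 1; ext x
    rw [← ofReal_norm, ENNReal.ofReal_rpow_of_nonneg (norm_nonneg _) (by linarith)]
  rcases hNn.eq_or_lt with h0 | hN0
  · have : eLpNorm f p' volume = 0 := by
      rw [eLpNorm_eq_lintegral_rpow_enorm_toReal hp'0 hp't, ← hq, hN', ← h0]
      simp; linarith
    have hz : f =ᵐ[volume] 0 := (eLpNorm_eq_zero_iff hm.aestronglyMeasurable hp'0).1 this
    have : 𝓕 f = 0 := by
      ext x
      rw [Real.fourier_congr_ae hz, Real.fourier_eq]
      simp
    rw [this]; simp
  · have := hy_aux hm i1 (hf 2) hP2 hqP hfq hN hN0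
    rw [eLpNorm_eq_lintegral_rpow_enorm_toReal hp'0 hp't,
      eLpNorm_eq_lintegral_rpow_enorm_toReal hp0 hpt, ← hq, hN', ← hPdef]
    have e : ∫⁻ x, ‖𝓕 f x‖ₑ ^ P = ∫⁻ x, ENNReal.ofReal (‖𝓕 f x‖ ^ P) := by
      congr 1; ext x
      rw [← ofReal_norm, ENNReal.ofReal_rpow_of_nonneg (norm_nonneg _) hPpos.le]
    rw [e]
    refine (ENNReal.rpow_le_rpow this (by positivity)).trans (le_of_eq ?_)
    rw [ENNReal.ofReal_rpow_of_nonneg (by positivity) (by positivity),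
      ENNReal.ofReal_rpow_of_nonneg hNn (by positivity), ← ENNReal.ofReal_mul (by positivity)]
    congr 1
    rw [Real.mul_rpow hC0.le (by positivity), ← Real.rpow_mul hNn]
    congr 2
    have : 1 / q = 1 - 1 / P := by linarith
    rw [this]; field_simp

theorem schr_eq {d : ℕ} {t : ℝ} (ht : t ≠ 0) (φ : EuclideanSpace ℝ (Fin d) → ℂ)
    (x : EuclideanSpace ℝ (Fin d)) :
    ‖schrodingerProp d t φ x‖ = (4 * π * |t|) ^ (-(d : ℝ) / 2) *
      ‖𝓕 (fun y => cexp (((‖y‖ ^ 2 / (4 * t) : ℝ) : ℂ) * I) * φ y) ((4 * π * t)⁻¹ • x)‖ := by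
  unfold schrodingerProp
  have htc : (t : ℂ) ≠ 0 := by exact_mod_cast ht
  rw [norm_mul]
  congr 1
  · rw [show (-(d : ℂ) / 2) = ((-(d : ℝ) / 2 : ℝ) : ℂ) by push_cast; rfl, Complex.norm_cpow_real]
    congr 1
    simp [abs_of_pos Real.pi_pos]
  · rw [Real.fourier_eq']
    have : ∀ y : EuclideanSpace ℝ (Fin d), cexp (I * ((‖x - y‖ : ℝ) ^ 2 : ℝ) / (4 * t)) * φ y =
        cexp (((‖x‖ ^ 2 / (4 * t) : ℝ) : ℂ) * I) *
        (cexp (((-2 * π * inner ℝ y ((4 * π * t)⁻¹ • x) : ℝ) : ℂ) * I) •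
          (cexp (((‖y‖ ^ 2 / (4 * t) : ℝ) : ℂ) * I) * φ y)) := by
      intro y
      rw [smul_eq_mul, ← mul_assoc, ← mul_assoc, ← Complex.exp_add, ← Complex.exp_add]
      congr 2
      rw [@norm_sub_sq_real, inner_smul_right, real_inner_comm]
      push_cast
      have : (π : ℂ) ≠ 0 := by exact_mod_cast Real.pi_ne_zero
      field_simp
      ring
    simp_rw [this]
    rw [integral_const_mul, norm_mul, Complex.norm_exp_ofReal_mul_I, one_mul]

theorem eLp_scale {d : ℕ} {a : ℝ} (ha : a ≠ 0) (g : EuclideanSpace ℝ (Fin d) → ℂ) (hg : Continuous g)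
    (p : ℝ≥0∞) : eLpNorm (fun x => g (a⁻¹ • x)) p volume =
      ENNReal.ofReal (|a| ^ ((d : ℝ) * p.toReal⁻¹)) * eLpNorm g p volume := by
  have h := eLpNorm_map_measure (p := p) (μ := (volume : Measure (EuclideanSpace ℝ (Fin d))))
    (f := fun x => a⁻¹ • x) (g := g) hg.aestronglyMeasurable (by fun_prop)
  have h' : eLpNorm (fun x => g (a⁻¹ • x)) p volume = eLpNorm (g ∘ fun x => a⁻¹ • x) p volume := rfl
  rw [h', ← h, Measure.map_addHaar_smul _ (inv_ne_zero ha), eLpNorm_smul_measure_of_ne_zero, smul_eq_mul]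
  · congr 1
    have : |((a⁻¹ ^ Module.finrank ℝ (EuclideanSpace ℝ (Fin d)))⁻¹)| = |a| ^ (d : ℝ) := by
      simp [abs_pow]
    rw [this, ENNReal.ofReal_rpow_of_nonneg (by positivity) (by positivity), ← Real.rpow_mul (abs_nonneg _)]
    simp
  · simp [ha]

/-- Dispersive estimate: for `t ≠ 0` and `1/p + 1/p' = 1` with `p' ∈ [1,2]`,
`‖T(t)φ‖_{L^p} ≤ c |t|^{−d(1/2 − 1/p)} ‖φ‖_{L^{p'}}` for Schwartz `φ`. -/
theorem dispersive_estimate (d : ℕ) (hd : 1 ≤ d) (p p' : ℝ≥0∞)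
    (hp'1 : 1 ≤ p') (hp'2 : p' ≤ 2) (hconj : 1 / p + 1 / p' = 1) :
    ∃ c : ℝ, 0 < c ∧ ∀ t : ℝ, t ≠ 0 →
      ∀ φ : SchwartzMap (EuclideanSpace ℝ (Fin d)) ℂ,
        eLpNorm (schrodingerProp d t ⇑φ) p volume ≤
          ENNReal.ofReal (c * |t| ^ (-(d : ℝ) * (1 / 2 - p.toReal⁻¹))) *
            eLpNorm (⇑φ) p' volume := by
  obtain ⟨C, hC, H⟩ := hy (d := d) p p' hp'1 hp'2 hconj
  refine ⟨(4 * π) ^ (-(d : ℝ) * (1 / 2 - p.toReal⁻¹)) * C, by positivity, fun t ht φ => ?_⟩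
  set ψ : EuclideanSpace ℝ (Fin d) → ℂ :=
    fun y => cexp (((‖y‖ ^ 2 / (4 * t) : ℝ) : ℂ) * I) * φ y with hψ
  have hψc : Continuous ψ := by
    have := φ.continuous
    fun_prop
  have hψn : ∀ y, ‖ψ y‖ = ‖φ y‖ := fun y => by
    rw [hψ]; simp only [norm_mul, Complex.norm_exp_ofReal_mul_I, one_mul]
  have hmem : ∀ r : ℝ≥0∞, MemLp ψ r := fun r =>
    (φ.memLp r).congr_norm hψc.aestronglyMeasurable (Filter.Eventually.of_forall fun y => (hψn y).symm)
  have hF := fourier_cont (memLp_one_iff_integrable.1 (hmem 1))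
  have ha : 4 * π * t ≠ 0 := by positivity
  have hK : 0 < (4 * π * |t|) ^ (-(d : ℝ) / 2) := by positivity
  have e1 : eLpNorm (schrodingerProp d t ⇑φ) p volume =
      eLpNorm ((((4 * π * |t|) ^ (-(d : ℝ) / 2) : ℝ) : ℂ) • fun x => 𝓕 ψ ((4 * π * t)⁻¹ • x)) p volume := by
    apply eLpNorm_congr_norm_ae
    filter_upwards with x
    rw [schr_eq ht, Pi.smul_apply, norm_smul, Complex.norm_real, Real.norm_of_nonneg hK.le]
  have e2 : eLpNorm ψ p' volume = eLpNorm φ p' volume :=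
    eLpNorm_congr_norm_ae (Filter.Eventually.of_forall hψn)
  rw [e1, eLpNorm_const_smul, eLp_scale ha _ hF, ← e2, ← ofReal_norm, Complex.norm_real,
    Real.norm_of_nonneg hK.le]
  calc _ ≤ ENNReal.ofReal ((4 * π * |t|) ^ (-(d : ℝ) / 2)) *
        (ENNReal.ofReal (|4 * π * t| ^ ((d : ℝ) * p.toReal⁻¹)) *
          (ENNReal.ofReal C * eLpNorm ψ p' volume)) := by
        gcongr
        exact H ψ hψc.measurable hmem
    _ = _ := by
        rw [← mul_assoc, ← mul_assoc, ← ENNReal.ofReal_mul (by positivity),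
          ← ENNReal.ofReal_mul (by positivity)]
        congr 2
        have habs : |4 * π * t| = 4 * π * |t| := by
          rw [abs_mul, abs_of_pos (by positivity)]
        have h4 : 0 < 4 * π * |t| := by positivity
        rw [habs, ← Real.rpow_add h4, mul_right_comm (_ ^ _) C, ← Real.mul_rpow (by positivity) (by positivity)]
        congr 2
        ring
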